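/- arXiv:1611.07622 — 2 statements merged into one kernel-verified Lean document; each statement's English description precedes it below -/
import Mathlib

section
/- A valid environment transition t_{s₁,s^e₂} ∈ ρ^e is a deadlock for the system if and only if the vertex v_{t_{s₁,s^e₂}} ∈ V^R₀ has exactly one outgoing edge, of weight −1, leading to v^loss₁ ∈ V^R₁ in C^loss, and no initial credit c ∈ ℕ suffices for player-0 to win from v_{s₁} ∈ V^R₁. -/
universe u v

/-- A symbolic weighted game graph `G^sym = ⟨θᵉ, θˢ, ρᵉ, ρˢ, w⟩` for reactive energy games.
`Se` is the type `𝒱_env` of assignments to the environment variables and `Ss` is the type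
`𝒱_sys` of assignments to the system variables; a state is a pair in `Se × Ss`.
`rhoE s se` says that the environment choice `se` is a valid environment transition from `s`
(`t_{s,se} ∈ ρᵉ`), and `rhoS s se ss` says the system choice `ss` completes it to a valid
system transition (`t_{s,se,ss} ∈ ρˢ`). The weight `w` is only relevant on valid transitions. -/
structure SymGG (Se : Type u) (Ss : Type v) where
  thetaE : Se → Prop
  thetaS : Se → Ss → Prop
  rhoE : Se × Ss → Se → Prop
  rhoS : Se × Ss → Se → Ss → Prop
  w : Se × Ss → Se × Ss → ℤ

variable {Se : Type u} {Ss : Type v}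

/-- A state `s` is a deadlock for the environment: no valid environment choice from `s`. -/
def SymGG.envDeadlock (G : SymGG Se Ss) (s : Se × Ss) : Prop := ¬ ∃ se, G.rhoE s se

/-- A valid environment transition `t_{s,se}` is a deadlock for the system: no valid
system completion. -/
def SymGG.sysDeadlock (G : SymGG Se Ss) (s : Se × Ss) (se : Se) : Prop := ¬ ∃ ss, G.rhoS s se ss

/-- An initial state `se ∈ θᵉ` is an initial deadlock for the system: no system choice `ss`
with `se ∪ ss ∈ θˢ`. -/
def SymGG.initSysDeadlock (G : SymGG Se Ss) (se : Se) : Prop := ¬ ∃ ss, G.thetaS se ss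

/-- Vertices of the reduced bipartite energy game graph `Γ^R`:
`init` is `v_∅`; `winP0,winP1` are `v₀^win, v₁^win` of the cycle `C^win`;
`lossP0,lossP1` are `v₀^loss, v₁^loss` of the cycle `C^loss`;
`initEnv se` is `v_{sᵉ}`; `state s` is `v_s`; `trans s se` is `v_{t_{s,sᵉ}}`. -/
inductive RV (Se : Type u) (Ss : Type v) : Type (max u v) where
  | init : RV Se Ss
  | winP0 : RV Se Ss
  | winP1 : RV Se Ss
  | lossP0 : RV Se Ss
  | lossP1 : RV Se Ss
  | initEnv (se : Se) : RV Se Ss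
  | state (s : Se × Ss) : RV Se Ss
  | trans (s : Se × Ss) (se : Se) : RV Se Ss

/-- The player-0 (system / maximizer) vertices `V₀^R` of `Γ^R`; the remaining vertices
are the player-1 (environment / minimizer) vertices `V₁^R`. -/
def RV.isP0 : RV Se Ss → Prop
  | .winP0 => True
  | .lossP0 => True
  | .initEnv _ => True
  | .trans _ _ => True
  | _ => False

/-- The edge relation `E^R` of the reduced energy game graph `Γ^R` obtained from `G^sym`. -/
inductive REdge (G : SymGG Se Ss) : RV Se Ss → RV Se Ss → Prop where
  | winCyc1 : REdge G .winP0 .winP1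
  | winCyc2 : REdge G .winP1 .winP0
  | lossCyc1 : REdge G .lossP0 .lossP1
  | lossCyc2 : REdge G .lossP1 .lossP0
  | emptyWin : (¬ ∃ se, G.thetaE se) → REdge G .init .winP0
  | toInitEnv {se : Se} : G.thetaE se → REdge G .init (.initEnv se)
  | initToState {se : Se} {ss : Ss} : G.thetaE se → G.thetaS se ss →
      REdge G (.initEnv se) (.state (se, ss))
  | initSysDead {se : Se} : G.thetaE se → (¬ ∃ ss, G.thetaS se ss) →
      REdge G (.initEnv se) .lossP1
  | envMove {s : Se × Ss} {se : Se} : G.rhoE s se → REdge G (.state s) (.trans s se)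
  | sysDead {s : Se × Ss} {se : Se} : G.rhoE s se → (¬ ∃ ss, G.rhoS s se ss) →
      REdge G (.trans s se) .lossP1
  | sysMove {s : Se × Ss} {se : Se} {ss : Ss} : G.rhoE s se → G.rhoS s se ss →
      REdge G (.trans s se) (.state (se, ss))
  | envDeadWin {s : Se × Ss} : (¬ ∃ se, G.rhoE s se) → REdge G (.state s) .winP0

/-- The weight function `w^R` of `Γ^R` (on non-edges its value is irrelevant). -/
def wR (G : SymGG Se Ss) : RV Se Ss → RV Se Ss → ℤ
  | .winP0, .winP1 => 1
  | .lossP0, .lossP1 => -1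
  | .initEnv _, .lossP1 => -1
  | .trans _ _, .lossP1 => -1
  | .trans s _, .state s2 => G.w s s2
  | _, _ => 0

/-- An (infinite) EG play on `Γ^R`. -/
def IsRPlay (G : SymGG Se Ss) (p : ℕ → RV Se Ss) : Prop :=
  ∀ i, REdge G (p i) (p (i + 1))

/-- The energy level `EL(p, j) = c + Σ_{i<j} w^R(p i, p (i+1))` of a play on `Γ^R`
for initial credit `c`. -/
def REL (G : SymGG Se Ss) (c : ℕ) (p : ℕ → RV Se Ss) (j : ℕ) : ℤ :=
  (c : ℤ) + ∑ i ∈ Finset.range j, wR G (p i) (p (i + 1))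

/-- Initial credit `c` suffices for player-0 to win the energy game on `Γ^R` from vertex `v`:
player-0 has a strategy (choosing valid edges at player-0 vertices, given the history)
such that every play from `v` consistent with it keeps the energy level non-negative. -/
def WinsFrom (G : SymGG Se Ss) (c : ℕ) (v : RV Se Ss) : Prop :=
  ∃ σ : List (RV Se Ss) → RV Se Ss → RV Se Ss,
    (∀ h u, RV.isP0 u → (∃ u', REdge G u u') → REdge G u (σ h u)) ∧
    ∀ p : ℕ → RV Se Ss, p 0 = v → IsRPlay G p →
      (∀ i, RV.isP0 (p i) → p (i + 1) = σ (List.ofFn fun k : Fin i => p k.1) (p i)) →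
      ∀ k, 1 ≤ k → 0 ≤ REL G c p k

/-- An infinite reactive EG play `p^sym = s₀s₁…` on `G^sym`: it starts at an initial state
in `θᵉ ∩ θˢ` and each step is a valid transition (environment choice completed by the system). -/
def IsReactivePlay (G : SymGG Se Ss) (q : ℕ → Se × Ss) : Prop :=
  (G.thetaE (q 0).1 ∧ G.thetaS (q 0).1 (q 0).2) ∧
  ∀ i, G.rhoE (q i) (q (i + 1)).1 ∧ G.rhoS (q i) (q (i + 1)).1 (q (i + 1)).2

/-- The energy level `EL(p^sym, j) = c + Σ_{i<j} w(s_i, s_{i+1})` of a reactive play on `G^sym`. -/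
def ELsym (G : SymGG Se Ss) (c : ℕ) (q : ℕ → Se × Ss) (j : ℕ) : ℤ :=
  (c : ℤ) + ∑ i ∈ Finset.range j, G.w (q i) (q (i + 1))

/-- The play on `Γ^R` corresponding to a reactive play `q` on `G^sym`:
`v_∅ v_{sᵉ₀} v_{s₀} v_{t_{s₀,sᵉ₁}} v_{s₁} v_{t_{s₁,sᵉ₂}} v_{s₂} …`. -/
def corr (q : ℕ → Se × Ss) : ℕ → RV Se Ss := fun n =>
  if n = 0 then .init
  else if n = 1 then .initEnv (q 0).1
  else if n % 2 = 0 then .state (q (n / 2 - 1))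
  else .trans (q (n / 2 - 1)) (q (n / 2)).1

/-- The play on `Γ^R` that stays in `C^loss` forever, starting at `v₁^loss`. -/
def lossPlay : ℕ → RV Se Ss
  | 0 => .lossP1
  | 1 => .lossP0
  | n + 2 => lossPlay n

/-- The play on `Γ^R` that moves from `v_s` through `v_{t_{s,sᵉ}}` into `C^loss`. -/
def deadlockPlay (s : Se × Ss) (se : Se) : ℕ → RV Se Ss
  | 0 => .state s
  | 1 => .trans s se
  | n + 2 => lossPlay n

theorem lossPlay_isRPlay (G : SymGG Se Ss) : IsRPlay G lossPlay
  | 0 => .lossCyc2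
  | 1 => .lossCyc1
  | n + 2 => lossPlay_isRPlay G n

theorem eq_lossPlay_succ_of_edge (G : SymGG Se Ss) {u : RV Se Ss} :
    ∀ n, (lossPlay n : RV Se Ss).isP0 → REdge G (lossPlay n) u → u = lossPlay (n + 1)
  | 0, h0, _ => h0.elim
  | 1, _, h => by cases h; rfl
  | n + 2, h0, h => eq_lossPlay_succ_of_edge G n h0 h

theorem sum_wR_lossPlay (G : SymGG Se Ss) (k : ℕ) :
    ∑ i ∈ Finset.range (2 * k), wR G (lossPlay i) (lossPlay (i + 1)) = -(k : ℤ) := by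
  induction k with
  | zero => simp
  | succ k ih =>
    rw [show 2 * (k + 1) = 2 * k + 1 + 1 by ring, Finset.sum_range_succ', Finset.sum_range_succ']
    change ∑ i ∈ Finset.range (2 * k), wR G (lossPlay i) (lossPlay (i + 1)) + -1 + 0 = _
    rw [ih]
    push_cast
    ring

theorem REdge.trans_iff_of_sysDeadlock {G : SymGG Se Ss} {s : Se × Ss} {se : Se}
    (h : G.rhoE s se) (hd : G.sysDeadlock s se) (u : RV Se Ss) :
    REdge G (.trans s se) u ↔ u = .lossP1 := by
  refine ⟨fun he => ?_, fun hu => hu ▸ .sysDead h hd⟩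
  cases he with
  | sysDead => rfl
  | sysMove _ hs => exact (hd ⟨_, hs⟩).elim

theorem deadlockPlay_isRPlay {G : SymGG Se Ss} {s : Se × Ss} {se : Se}
    (h : G.rhoE s se) (hd : G.sysDeadlock s se) : IsRPlay G (deadlockPlay s se)
  | 0 => .envMove h
  | 1 => .sysDead h hd
  | n + 2 => lossPlay_isRPlay G n

theorem eq_deadlockPlay_succ_of_edge {G : SymGG Se Ss} {s : Se × Ss} {se : Se}
    (h : G.rhoE s se) (hd : G.sysDeadlock s se) {u : RV Se Ss} :
    ∀ n, (deadlockPlay s se n).isP0 → REdge G (deadlockPlay s se n) u →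
      u = deadlockPlay s se (n + 1)
  | 0, h0, _ => h0.elim
  | 1, _, he => (REdge.trans_iff_of_sysDeadlock h hd u).1 he
  | n + 2, h0, he => eq_lossPlay_succ_of_edge G n h0 he

theorem REL_deadlockPlay (G : SymGG Se Ss) (s : Se × Ss) (se : Se) (c k : ℕ) :
    REL G c (deadlockPlay s se) (2 * k + 2) = c - 1 - k := by
  rw [REL, Finset.sum_range_succ', Finset.sum_range_succ']
  change (c : ℤ) +
    (∑ i ∈ Finset.range (2 * k), wR G (lossPlay i) (lossPlay (i + 1)) + -1 + 0) = _
  rw [sum_wR_lossPlay]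
  ring

theorem not_winsFrom_of_sysDeadlock {G : SymGG Se Ss} {s : Se × Ss} {se : Se}
    (h : G.rhoE s se) (hd : G.sysDeadlock s se) (c : ℕ) : ¬ WinsFrom G c (.state s) := by
  rintro ⟨σ, hσ, hwin⟩
  have hplay := deadlockPlay_isRPlay h hd
  have hnonneg := hwin (deadlockPlay s se) rfl hplay
    (fun i hi => (eq_deadlockPlay_succ_of_edge h hd i hi (hσ _ _ hi ⟨_, hplay i⟩)).symm)
    (2 * c + 2) (by omega)
  rw [REL_deadlockPlay] at hnonneg
  omega

/-- Lemma 4: a valid environment transition `t_{s₁,sᵉ₂} ∈ ρᵉ` is a deadlock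
for the system iff `v_{t_{s₁,sᵉ₂}} ∈ V₀^R` has exactly one outgoing edge, of weight `-1`, to
`v₁^loss ∈ V₁^R` in `C^loss`, and no initial credit `c ∈ ℕ` suffices for player-0 to win
from `v_{s₁} ∈ V₁^R`. -/
theorem stmt3 (G : SymGG Se Ss) (s1 : Se × Ss) (se2 : Se) (h : G.rhoE s1 se2) :
    G.sysDeadlock s1 se2 ↔
      ((∀ u, REdge G (RV.trans s1 se2) u ↔ u = RV.lossP1) ∧
        wR G (RV.trans s1 se2) RV.lossP1 = -1 ∧
        ¬ ∃ c : ℕ, WinsFrom G c (RV.state s1)) := by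
  constructor
  · intro hd
    exact ⟨REdge.trans_iff_of_sysDeadlock h hd, rfl,
      fun ⟨c, hc⟩ => not_winsFrom_of_sysDeadlock h hd c hc⟩
  · rintro ⟨hu, -, -⟩
    cases (hu _).2 rfl with
    | sysDead _ hd => exact hd
end

section
/- Given an initial credit c ∈ ℕ, for all e ∈ ℤ, n ∈ ℕ, and 1 ≤ j < n: there exists a finite losing reactive EG play p^sym = s₀s₁…s_{n−1}s^e_n on G^sym that ends with a deadlock for the system and has EL(p^sym,j) = e if and only if there exists an EG play p = v_∅ v_{s^e₀} v_{s₀} v_{t_{s₀,s^e₁}} v_{s₁} … v_{s_{n−1}} v_{t_{s_{n−1},s^e_n}} (v^loss₁ v^loss₀)^ω on Γ^R with EL(p, 2+2j) = e and there exists k ≥ 1 with EL(p,k) < 0. -/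
universe u v

variable {Se : Type u} {Ss : Type v}

/-- The play `v_∅ v_{sᵉ₀} v_{s₀} … v_{s_{n-1}} v_{t_{s_{n-1},sᵉ_n}} (v₁^loss v₀^loss)^ω`
on `Γ^R`. -/
def corrLoss (q : ℕ → Se × Ss) (sen : Se) (n : ℕ) : ℕ → RV Se Ss := fun k =>
  if k ≤ 2 * n then corr q k
  else if k = 2 * n + 1 then .trans (q (n - 1)) sen
  else if (k - (2 * n + 1)) % 2 = 1 then .lossP1 else .lossP0

theorem corrLoss_zero (q : ℕ → Se × Ss) (sen : Se) (n : ℕ) : corrLoss q sen n 0 = .init := by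
  simp [corrLoss, corr]

theorem corrLoss_one (q : ℕ → Se × Ss) (sen : Se) {n : ℕ} (hn : 0 < n) :
    corrLoss q sen n 1 = .initEnv (q 0).1 := by
  have h : 1 ≤ 2 * n := by omega
  simp [corrLoss, corr, h]

theorem corrLoss_even (q : ℕ → Se × Ss) (sen : Se) {n m : ℕ} (hm : m < n) :
    corrLoss q sen n (2 * m + 2) = .state (q m) := by
  have h : 2 * m + 2 ≤ 2 * n := by omega
  have h' : (2 * m + 2) / 2 - 1 = m := by omega
  have h'' : (2 * m + 2) % 2 = 0 := by omega
  simp only [corrLoss, corr, if_pos h, h', h'']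
  simp

theorem corrLoss_odd (q : ℕ → Se × Ss) (sen : Se) {n m : ℕ} (hm : m + 1 < n) :
    corrLoss q sen n (2 * m + 3) = .trans (q m) (q (m + 1)).1 := by
  have h : 2 * m + 3 ≤ 2 * n := by omega
  have h' : (2 * m + 3) / 2 = m + 1 := by omega
  have h'' : (2 * m + 3) % 2 = 1 := by omega
  simp only [corrLoss, corr, if_pos h, h', h'']
  simp

theorem corrLoss_last (q : ℕ → Se × Ss) (sen : Se) (n : ℕ) :
    corrLoss q sen n (2 * n + 1) = .trans (q (n - 1)) sen := by
  simp [corrLoss]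

theorem corrLoss_lossP1 (q : ℕ → Se × Ss) (sen : Se) (n m : ℕ) :
    corrLoss q sen n (2 * n + 2 + 2 * m) = .lossP1 := by
  have h : ¬ 2 * n + 2 + 2 * m ≤ 2 * n := by omega
  have h' : ¬ 2 * n + 2 + 2 * m = 2 * n + 1 := by omega
  have h'' : (2 * n + 2 + 2 * m - (2 * n + 1)) % 2 = 1 := by omega
  simp only [corrLoss, if_neg h, if_neg h', if_pos h'']

theorem corrLoss_lossP0 (q : ℕ → Se × Ss) (sen : Se) (n m : ℕ) :
    corrLoss q sen n (2 * n + 3 + 2 * m) = .lossP0 := by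
  have h : ¬ 2 * n + 3 + 2 * m ≤ 2 * n := by omega
  have h' : ¬ 2 * n + 3 + 2 * m = 2 * n + 1 := by omega
  have h'' : ¬ (2 * n + 3 + 2 * m - (2 * n + 1)) % 2 = 1 := by omega
  simp only [corrLoss, if_neg h, if_neg h', if_neg h'']

/-- The sequence `corrLoss q sen n` is a play on `Γ^R` exactly when `q`, cut after `n` states and
followed by `sen`, is a reactive play that ends with a deadlock for the system. -/
theorem isRPlay_corrLoss_iff (G : SymGG Se Ss) (q : ℕ → Se × Ss) (sen : Se) {n : ℕ} (hn : 0 < n) :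
    IsRPlay G (corrLoss q sen n) ↔
      (G.thetaE (q 0).1 ∧ G.thetaS (q 0).1 (q 0).2) ∧
        (∀ i, i < n - 1 → G.rhoE (q i) (q (i + 1)).1 ∧
          G.rhoS (q i) (q (i + 1)).1 (q (i + 1)).2) ∧
        G.rhoE (q (n - 1)) sen ∧ G.sysDeadlock (q (n - 1)) sen := by
  obtain ⟨N, rfl⟩ : ∃ N, n = N + 1 := ⟨n - 1, by omega⟩
  simp only [Nat.add_sub_cancel]
  have hlast := corrLoss_last q sen (N + 1)
  simp only [Nat.add_sub_cancel] at hlast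
  constructor
  · intro h
    refine ⟨?_, fun i hi => ?_, ?_⟩
    · have h1 := h 1
      rw [corrLoss_one q sen hn, show 1 + 1 = 2 * 0 + 2 from rfl, corrLoss_even q sen hn] at h1
      generalize q 0 = s at h1 ⊢
      obtain ⟨a, b⟩ := s
      cases h1 with
      | initToState hE hS => exact ⟨hE, hS⟩
    · have h1 := h (2 * i + 3)
      rw [corrLoss_odd q sen (by omega), show 2 * i + 3 + 1 = 2 * (i + 1) + 2 by ring,
        corrLoss_even q sen (by omega)] at h1
      generalize q (i + 1) = s at h1 ⊢
      obtain ⟨a, b⟩ := s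
      cases h1 with
      | sysMove hE hS => exact ⟨hE, hS⟩
    · have h1 := h (2 * (N + 1) + 1)
      rw [hlast, show 2 * (N + 1) + 1 + 1 = 2 * (N + 1) + 2 + 2 * 0 by ring,
        corrLoss_lossP1] at h1
      cases h1 with
      | sysDead hE hS => exact ⟨hE, hS⟩
  · rintro ⟨⟨hE, hS⟩, hstep, hE', hS'⟩ k
    obtain rfl | rfl | ⟨m, hm, rfl⟩ | ⟨m, hm, rfl⟩ | rfl | rfl | ⟨m, rfl⟩ | ⟨m, rfl⟩ :
        k = 0 ∨ k = 1 ∨ (∃ m, m < N ∧ k = 2 * m + 2) ∨ (∃ m, m < N ∧ k = 2 * m + 3) ∨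
          k = 2 * N + 2 ∨ k = 2 * (N + 1) + 1 ∨ (∃ m, k = 2 * (N + 1) + 2 + 2 * m) ∨
          ∃ m, k = 2 * (N + 1) + 3 + 2 * m := by
      rcases Nat.even_or_odd' k with ⟨a, rfl | rfl⟩
      · by_cases h0 : a = 0
        · omega
        · by_cases h1 : a - 1 < N
          · exact .inr (.inr (.inl ⟨a - 1, h1, by omega⟩))
          · by_cases h2 : a = N + 1
            · omega
            · exact .inr (.inr (.inr (.inr (.inr (.inr (.inl ⟨a - (N + 2), by omega⟩))))))
      · by_cases h0 : a = 0
        · omega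
        · by_cases h1 : a - 1 < N
          · exact .inr (.inr (.inr (.inl ⟨a - 1, h1, by omega⟩)))
          · by_cases h2 : a = N + 1
            · omega
            · exact .inr (.inr (.inr (.inr (.inr (.inr (.inr ⟨a - (N + 2), by omega⟩))))))
    · rw [corrLoss_zero, corrLoss_one q sen hn]
      exact .toInitEnv hE
    · rw [corrLoss_one q sen hn, show 1 + 1 = 2 * 0 + 2 from rfl, corrLoss_even q sen hn]
      exact .initToState hE hS
    · rw [corrLoss_even q sen (by omega), corrLoss_odd q sen (by omega)]
      exact .envMove (hstep m hm).1
    · rw [corrLoss_odd q sen (by omega), show 2 * m + 3 + 1 = 2 * (m + 1) + 2 by ring,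
        corrLoss_even q sen (by omega)]
      exact .sysMove (hstep m hm).1 (hstep m hm).2
    · rw [corrLoss_even q sen (by omega), show 2 * N + 2 + 1 = 2 * (N + 1) + 1 by ring, hlast]
      exact .envMove hE'
    · rw [hlast, show 2 * (N + 1) + 1 + 1 = 2 * (N + 1) + 2 + 2 * 0 by ring, corrLoss_lossP1]
      exact .sysDead hE' hS'
    · rw [corrLoss_lossP1, show 2 * (N + 1) + 2 + 2 * m + 1 = 2 * (N + 1) + 3 + 2 * m by ring,
        corrLoss_lossP0]
      exact .lossCyc2
    · rw [corrLoss_lossP0,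
        show 2 * (N + 1) + 3 + 2 * m + 1 = 2 * (N + 1) + 2 + 2 * (m + 1) by ring, corrLoss_lossP1]
      exact .lossCyc1

theorem REL_succ (G : SymGG Se Ss) (c : ℕ) (p : ℕ → RV Se Ss) (j : ℕ) :
    REL G c p (j + 1) = REL G c p j + wR G (p j) (p (j + 1)) := by
  simp only [REL, Finset.sum_range_succ]
  ring

/-- Energy levels along `q` are preserved by the correspondence: `s_j` is vertex `2 * j + 2`. -/
theorem REL_corrLoss (G : SymGG Se Ss) (c : ℕ) (q : ℕ → Se × Ss) (sen : Se) {n : ℕ} (j : ℕ)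
    (hj : j < n) : REL G c (corrLoss q sen n) (2 * j + 2) = ELsym G c q j := by
  induction j with
  | zero =>
    rw [show 2 * 0 + 2 = 0 + 1 + 1 from rfl, REL_succ, REL_succ, corrLoss_zero,
      corrLoss_one q sen hj, show 0 + 1 + 1 = 2 * 0 + 2 from rfl, corrLoss_even q sen hj]
    simp [REL, ELsym, wR]
  | succ j ih =>
    rw [show 2 * (j + 1) + 2 = 2 * j + 2 + 1 + 1 by ring, REL_succ, REL_succ, ih (by omega),
      corrLoss_even q sen (by omega), corrLoss_odd q sen hj,
      show 2 * j + 2 + 1 + 1 = 2 * (j + 1) + 2 by ring, corrLoss_even q sen hj]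
    simp only [ELsym, Finset.sum_range_succ, wR]
    ring

/-- Each round of the cycle `C^loss` lowers the energy level by one. -/
theorem REL_corrLoss_loss (G : SymGG Se Ss) (c : ℕ) (q : ℕ → Se × Ss) (sen : Se) (n m : ℕ) :
    REL G c (corrLoss q sen n) (2 * n + 2 + 2 * m) =
      REL G c (corrLoss q sen n) (2 * n + 2) - m := by
  induction m with
  | zero => simp
  | succ m ih =>
    rw [show 2 * n + 2 + 2 * (m + 1) = 2 * n + 2 + 2 * m + 1 + 1 by ring, REL_succ, REL_succ, ih,
      corrLoss_lossP1, show 2 * n + 2 + 2 * m + 1 = 2 * n + 3 + 2 * m by ring, corrLoss_lossP0,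
      show 2 * n + 3 + 2 * m + 1 = 2 * n + 2 + 2 * (m + 1) by ring, corrLoss_lossP1]
    simp only [wR]
    push_cast
    ring

theorem exists_REL_corrLoss_neg (G : SymGG Se Ss) (c : ℕ) (q : ℕ → Se × Ss) (sen : Se) (n : ℕ) :
    ∃ k, 1 ≤ k ∧ REL G c (corrLoss q sen n) k < 0 := by
  refine ⟨2 * n + 2 + 2 * ((REL G c (corrLoss q sen n) (2 * n + 2)).toNat + 1), by omega, ?_⟩
  rw [REL_corrLoss_loss]
  omega

/-- Theorem 4: given an initial credit `c`, for all `e ∈ ℤ`, `n ∈ ℕ`, and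
`1 ≤ j < n`, there is a finite losing reactive EG play `p^sym = s₀…s_{n-1}sᵉ_n` on `G^sym`
ending with a deadlock for the system and `EL(p^sym, j) = e` iff there is an EG play
`p = v_∅ v_{sᵉ₀} v_{s₀} … v_{s_{n-1}} v_{t_{s_{n-1},sᵉ_n}} (v₁^loss v₀^loss)^ω` on `Γ^R`
with `EL(p, 2+2j) = e` and some `k ≥ 1` with `EL(p, k) < 0`. -/
theorem stmt10 (G : SymGG Se Ss) (c : ℕ) (e : ℤ) (n j : ℕ) (h1 : 1 ≤ j) (h2 : j < n) :
    (∃ (q : ℕ → Se × Ss) (sen : Se),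
        (G.thetaE (q 0).1 ∧ G.thetaS (q 0).1 (q 0).2) ∧
        (∀ i, i < n - 1 → G.rhoE (q i) (q (i + 1)).1 ∧
          G.rhoS (q i) (q (i + 1)).1 (q (i + 1)).2) ∧
        G.rhoE (q (n - 1)) sen ∧ G.sysDeadlock (q (n - 1)) sen ∧
        ELsym G c q j = e) ↔
      (∃ (q : ℕ → Se × Ss) (sen : Se), IsRPlay G (corrLoss q sen n) ∧
        REL G c (corrLoss q sen n) (2 + 2 * j) = e ∧
        ∃ k, 1 ≤ k ∧ REL G c (corrLoss q sen n) k < 0) := by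
  refine exists_congr fun q => exists_congr fun sen => ?_
  rw [isRPlay_corrLoss_iff G q sen (by omega), Nat.add_comm 2 (2 * j), REL_corrLoss G c q sen j h2]
  have hneg := exists_REL_corrLoss_neg G c q sen n
  tauto
end
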